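/- Every finite-dimensional algebra over a field is rank-stable: let F be a field, let A be a finite-dimensional F-algebra, and let A ≅ F⟨x_1,…,x_d⟩/⟨P_1,…,P_r⟩ be any finite presentation of A by noncommutative polynomials P_1,…,P_r ∈ F⟨x_1,…,x_d⟩. Then this presentation is rank-stable. -/

import Mathlib

open Matrix

noncomputable section

/-- Zero-padding of a square matrix to size `m` (the ℕ×ℕ extension `Â`, clipped to size `m`). -/
def padTo {F : Type} [Zero F] {n : ℕ} (m : ℕ) (A : Matrix (Fin n) (Fin n) F) :
    Matrix (Fin m) (Fin m) F :=
  Matrix.of fun i j =>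
    if h : (i : ℕ) < n ∧ (j : ℕ) < n then A ⟨i, h.1⟩ ⟨j, h.2⟩ else 0

/-- `Rank(Â − B̂)` for `A ∈ M_n(F)` and `B ∈ M_{n'}(F)`. -/
def padRankDiff {F : Type} [Field F] {n n' : ℕ} (A : Matrix (Fin n) (Fin n) F)
    (B : Matrix (Fin n') (Fin n') F) : ℕ :=
  (padTo (max n n') A - padTo (max n n') B).rank

/-- Evaluation of a noncommutative polynomial `P ∈ F⟨x_s : s ∈ σ⟩` at a tuple of matrices,
where scalar terms are interpreted as scalar matrices. -/
def evalPoly {F : Type} [Field F] {σ : Type} {n : ℕ}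
    (P : FreeAlgebra F σ) (A : σ → Matrix (Fin n) (Fin n) F) :
    Matrix (Fin n) (Fin n) F :=
  FreeAlgebra.lift F A P

/-- Rank-stability of the presentation `F⟨x_s : s ∈ σ⟩ / ⟨P_i : i ∈ ι⟩`. -/
def RankStable (F : Type) [Field F] {σ ι : Type} (P : ι → FreeAlgebra F σ) : Prop :=
  ∀ ε : ℝ, 0 < ε → ∃ δ : ℝ, 0 < δ ∧
    ∀ n : ℕ, 0 < n → ∀ A : σ → Matrix (Fin n) (Fin n) F,
      (∀ i, ((evalPoly (P i) A).rank : ℝ) < δ * n) →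
      ∃ n' : ℕ, 0 < n' ∧ ∃ B : σ → Matrix (Fin n') (Fin n') F,
        (∀ i, evalPoly (P i) B = 0) ∧
        ∀ j, ((padRankDiff (A j) (B j) : ℝ) < ε * n)

open Module

theorem exists_linearEquiv_agreeing {F E V : Type*} [Field F] [AddCommGroup E] [Module F E]
    [FiniteDimensional F E] [AddCommGroup V] [Module F V] [FiniteDimensional F V]
    (j : E →ₗ[F] V) (hj : Function.Injective j) (W : Submodule F V)
    (h : finrank F E = finrank F W) :
    ∃ φ : E ≃ₗ[F] W, ∀ x, j x ∈ W → (φ x : V) = j x := by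
  let e := LinearEquiv.ofFinrankEq E W h
  let f : W.comap j →ₗ[F] E := e.symm.toLinearMap ∘ₗ j.restrict (fun x hx => hx)
  have hf : Function.Injective f := by
    refine e.symm.injective.comp fun x y hxy => ?_
    exact Subtype.ext (hj (congrArg Subtype.val hxy))
  obtain ⟨g, hg⟩ := Submodule.exists_linearEquiv_restrict_eq (LinearEquiv.ofInjective f hf)
  refine ⟨g.trans e, fun x hx => ?_⟩
  have := hg ⟨x, hx⟩
  rw [LinearEquiv.trans_apply, ← this]
  simp [f]

theorem Matrix.rank_add_le {F m n : Type*} [Field F] [Fintype m] [Fintype n]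
    (A B : Matrix m n F) : (A + B).rank ≤ A.rank + B.rank := by
  unfold Matrix.rank
  rw [Matrix.mulVecLin_add]
  exact (Submodule.finrank_mono (LinearMap.range_add_le _ _)).trans
    (Submodule.finrank_add_le_finrank_add_finrank _ _)

theorem Matrix.rank_neg {F m n : Type*} [Field F] [Fintype n]
    (A : Matrix m n F) : (-A).rank = A.rank := by
  unfold Matrix.rank
  have : (-A).mulVecLin = -A.mulVecLin := by ext; simp
  rw [this, LinearMap.range_neg]

/-- The matrix of the inclusion of `F^m` into `F^n` as the first `m` coordinates. -/
def padIncl (F : Type) [Field F] {m n : ℕ} (h : m ≤ n) : Matrix (Fin n) (Fin m) F :=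
  (1 : Matrix (Fin n) (Fin n) F).submatrix id (Fin.castLE h)

theorem padIncl_transpose_mul (F : Type) [Field F] {m n : ℕ} (h : m ≤ n) :
    (padIncl F h)ᵀ * padIncl F h = 1 := by
  ext i j
  rw [Matrix.mul_apply, Finset.sum_eq_single (Fin.castLE h j)]
  · simp [padIncl, Matrix.one_apply, Fin.ext_iff, eq_comm]
  · intro k _ hk
    simp [padIncl, hk]
  · simp

theorem padIncl_mulVecLin_injective (F : Type) [Field F] {m n : ℕ} (h : m ≤ n) :
    Function.Injective (padIncl F h).mulVecLin := by
  refine Function.LeftInverse.injective (g := (padIncl F h)ᵀ.mulVecLin) fun x => ?_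
  rw [Matrix.mulVecLin_apply, Matrix.mulVecLin_apply, Matrix.mulVec_mulVec,
    padIncl_transpose_mul, Matrix.one_mulVec]

theorem rank_padIncl (F : Type) [Field F] {m n : ℕ} (h : m ≤ n) :
    (padIncl F h).rank = m := by
  rw [Matrix.rank, LinearMap.finrank_range_of_inj (padIncl_mulVecLin_injective F h)]
  simp

theorem padTo_self {F : Type} [Zero F] {n : ℕ} (A : Matrix (Fin n) (Fin n) F) :
    padTo n A = A := by
  ext i j
  simp [padTo]

theorem padTo_eq_mul {F : Type} [Field F] {m n : ℕ} (h : m ≤ n)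
    (B : Matrix (Fin m) (Fin m) F) :
    padTo n B = padIncl F h * B * (padIncl F h)ᵀ := by
  have key : ∀ (i : Fin n) (f : Fin m → F),
      ∑ k, padIncl F h i k * f k = if hi : (i : ℕ) < m then f ⟨i, hi⟩ else 0 := by
    intro i f
    split_ifs with hi
    · rw [Finset.sum_eq_single ⟨i, hi⟩]
      · simp [padIncl, Matrix.one_apply]
      · intro k _ hk
        have : (i : ℕ) ≠ k := fun hc => hk (Fin.ext hc.symm)
        simp [padIncl, Fin.ext_iff, this]
      · simp
    · refine Finset.sum_eq_zero fun k _ => ?_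
      have : (i : ℕ) ≠ k := fun hc => hi (hc ▸ k.2)
      simp [padIncl, Fin.ext_iff, this]
  ext i j
  rw [Matrix.mul_assoc, Matrix.mul_apply, key]
  by_cases hi : (i : ℕ) < m
  · rw [dif_pos hi, Matrix.mul_apply]
    simp_rw [Matrix.transpose_apply, mul_comm (B _ _)]
    rw [key]
    by_cases hj : (j : ℕ) < m <;> simp [padTo, hi, hj]
  · simp [padTo, hi]

theorem rank_one_sub_padIncl (F : Type) [Field F] {m n : ℕ} (h : m ≤ n) :
    (1 - padIncl F h * (padIncl F h)ᵀ).rank ≤ n - m := by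
  have hz : (1 - padIncl F h * (padIncl F h)ᵀ) * padIncl F h = 0 := by
    rw [Matrix.sub_mul, Matrix.mul_assoc, padIncl_transpose_mul]
    simp
  have := Matrix.rank_add_rank_le_card_of_mul_eq_zero hz
  rw [rank_padIncl, Fintype.card_fin] at this
  omega

/-- If `A` restricts to `B` along an embedding `Φ` close to the coordinate inclusion, then `B` is
close to `A` in rank. -/
theorem padRankDiff_le {F : Type} [Field F] {m n : ℕ} (h : m ≤ n)
    (A : Matrix (Fin n) (Fin n) F) (B : Matrix (Fin m) (Fin m) F)
    (Φ : Matrix (Fin n) (Fin m) F) (hΦ : Φ * B = A * Φ)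
    (hrank : (Φ - padIncl F h).rank ≤ n - m) :
    padRankDiff A B ≤ 3 * (n - m) := by
  have hN : ∀ N, N = n → (padTo N A - padTo N B).rank ≤ 3 * (n - m) := by
    rintro N rfl
    rw [padTo_self, padTo_eq_mul h]
    set J := padIncl F h
    have hdecomp : A - J * B * Jᵀ =
        A * (1 - J * Jᵀ) + (-(A * (Φ - J)) + (Φ - J) * B) * Jᵀ := by
      have : -(A * (Φ - J)) + (Φ - J) * B = A * J - J * B := by
        rw [Matrix.mul_sub, Matrix.sub_mul, hΦ]
        abel
      rw [this, Matrix.mul_sub, Matrix.sub_mul]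
      simp [Matrix.mul_assoc]
    rw [hdecomp]
    have h1 := (Matrix.rank_mul_le_right A (1 - J * Jᵀ)).trans (rank_one_sub_padIncl F h)
    have h2 := (Matrix.rank_mul_le_right A (Φ - J)).trans hrank
    have h3 := (Matrix.rank_mul_le_left (Φ - J) B).trans hrank
    have h4 := Matrix.rank_mul_le_left (-(A * (Φ - J)) + (Φ - J) * B) Jᵀ
    have h5 := Matrix.rank_add_le (-(A * (Φ - J))) ((Φ - J) * B)
    have h6 := Matrix.rank_add_le (A * (1 - J * Jᵀ)) ((-(A * (Φ - J)) + (Φ - J) * B) * Jᵀ)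
    rw [Matrix.rank_neg] at h5
    omega
  exact hN _ (max_eq_left h)

theorem evalPoly_intertwine {F : Type} [Field F] {σ : Type} {m n : ℕ}
    (A : σ → Matrix (Fin n) (Fin n) F) (B : σ → Matrix (Fin m) (Fin m) F)
    (Φ : Matrix (Fin n) (Fin m) F) (hΦ : ∀ j, Φ * B j = A j * Φ) (y : FreeAlgebra F σ) :
    Φ * evalPoly y B = evalPoly y A * Φ := by
  unfold evalPoly
  induction y using FreeAlgebra.induction with
  | grade0 c => simp [Algebra.algebraMap_eq_smul_one]
  | grade1 x => simpa using hΦ x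
  | mul a b ha hb => rw [map_mul, map_mul, ← Matrix.mul_assoc, ha, Matrix.mul_assoc, hb,
      Matrix.mul_assoc]
  | add a b ha hb => rw [map_add, map_add, Matrix.mul_add, ha, hb, Matrix.add_mul]

/-- A tuple of matrices leaving a subspace `W` invariant, and satisfying given relations on it,
is `3 (n - dim W)`-close in rank to a solution of these relations of size `dim W`. -/
theorem exists_solution_of_invariant {F : Type} [Field F] {σ ι : Type} {n : ℕ}
    (P : ι → FreeAlgebra F σ) (A : σ → Matrix (Fin n) (Fin n) F)
    (W : Submodule F (Fin n → F)) (hW : ∀ j, ∀ w ∈ W, A j *ᵥ w ∈ W)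
    (hP : ∀ i, ∀ w ∈ W, evalPoly (P i) A *ᵥ w = 0) :
    ∃ B : σ → Matrix (Fin (finrank F W)) (Fin (finrank F W)) F,
      (∀ i, evalPoly (P i) B = 0) ∧ ∀ j, padRankDiff (A j) (B j) ≤ 3 * (n - finrank F W) := by
  have hle : finrank F W ≤ n := by simpa using W.finrank_le
  obtain ⟨φ, hφ⟩ := exists_linearEquiv_agreeing (padIncl F hle).mulVecLin
    (padIncl_mulVecLin_injective F hle) W (by simp)
  let Φ : Matrix (Fin n) (Fin (finrank F W)) F := LinearMap.toMatrix' (W.subtype ∘ₗ φ.toLinearMap)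
  have hΦ : ∀ x, Φ *ᵥ x = φ x := fun x => by simp [Φ, LinearMap.toMatrix'_mulVec]
  let B : σ → Matrix (Fin (finrank F W)) (Fin (finrank F W)) F := fun j =>
    LinearMap.toMatrix' (φ.symm.toLinearMap ∘ₗ (A j).mulVecLin.restrict (hW j) ∘ₗ φ.toLinearMap)
  have hB : ∀ j, Φ * B j = A j * Φ := by
    intro j
    refine Matrix.ext_of_mulVec_single fun k => ?_
    rw [← Matrix.mulVec_mulVec, ← Matrix.mulVec_mulVec, hΦ, hΦ, LinearMap.toMatrix'_mulVec]
    simp only [LinearMap.comp_apply, LinearEquiv.coe_coe, LinearEquiv.apply_symm_apply]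
    rfl
  have hrank : (Φ - padIncl F hle).rank ≤ n - finrank F W := by
    set J := padIncl F hle
    have hker : W.comap J.mulVecLin ≤ LinearMap.ker (Φ - J).mulVecLin := by
      intro x hx
      have := hφ x hx
      rw [LinearMap.mem_ker, Matrix.mulVecLin_apply, Matrix.sub_mulVec, hΦ, this]
      simp
    have h1 := Submodule.finrank_mono hker
    have h2 := LinearMap.finrank_range_add_finrank_ker (Φ - J).mulVecLin
    have h3 : finrank F (W.comap J.mulVecLin) = finrank F (LinearMap.range J.mulVecLin ⊓ W :
        Submodule F (Fin n → F)) := by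
      rw [← Submodule.map_comap_eq]
      exact (LinearEquiv.finrank_eq (Submodule.equivMapOfInjective _
        (padIncl_mulVecLin_injective F hle) _))
    have h4 := Submodule.finrank_sup_add_finrank_inf_eq (LinearMap.range J.mulVecLin) W
    have h5 := (LinearMap.range J.mulVecLin ⊔ W).finrank_le
    have h6 : finrank F (LinearMap.range J.mulVecLin) = finrank F W := rank_padIncl F hle
    rw [Module.finrank_fin_fun] at h2 h5
    change finrank F (LinearMap.range (Φ - J).mulVecLin) ≤ _
    omega
  refine ⟨B, fun i => ?_, fun j => padRankDiff_le hle (A j) (B j) Φ (hB j) hrank⟩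
  refine Matrix.ext_of_mulVec_single fun k => ?_
  have h0 : Φ *ᵥ (evalPoly (P i) B *ᵥ Pi.single k 1) = 0 := by
    rw [Matrix.mulVec_mulVec, evalPoly_intertwine A B Φ hB, ← Matrix.mulVec_mulVec, hΦ]
    exact hP i _ (φ _).2
  rw [hΦ, Submodule.coe_eq_zero, LinearEquiv.map_eq_zero_iff] at h0
  rw [h0, Matrix.zero_mulVec]

/-- The rank of the value of an element of a two-sided ideal is linearly bounded in terms of the
ranks of the values of the generators. -/
theorem exists_rank_evalPoly_le {F : Type} [Field F] {σ ι : Type} (P : ι → FreeAlgebra F σ)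
    {y : FreeAlgebra F σ} (hy : y ∈ TwoSidedIdeal.span (Set.range P)) :
    ∃ C : ℝ, ∀ (n : ℕ) (A : σ → Matrix (Fin n) (Fin n) F) (t : ℝ),
      (∀ i, ((evalPoly (P i) A).rank : ℝ) ≤ t) → ((evalPoly y A).rank : ℝ) ≤ C * t := by
  induction hy using TwoSidedIdeal.span_induction with
  | mem x h =>
    obtain ⟨i, rfl⟩ := h
    exact ⟨1, fun n A t ht => by simpa using ht i⟩
  | zero => exact ⟨0, fun n A t ht => by simp [evalPoly]⟩
  | add x y _ _ hx hy =>
    obtain ⟨C, hC⟩ := hx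
    obtain ⟨D, hD⟩ := hy
    refine ⟨C + D, fun n A t ht => ?_⟩
    have h : ((evalPoly (x + y) A).rank : ℝ) ≤ (evalPoly x A).rank + (evalPoly y A).rank := by
      unfold evalPoly
      rw [map_add]
      exact_mod_cast Matrix.rank_add_le _ _
    linarith [hC n A t ht, hD n A t ht]
  | neg x _ hx =>
    obtain ⟨C, hC⟩ := hx
    refine ⟨C, fun n A t ht => ?_⟩
    have := hC n A t ht
    unfold evalPoly at this ⊢
    rwa [map_neg, Matrix.rank_neg]
  | left_absorb a x _ hx =>
    obtain ⟨C, hC⟩ := hx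
    refine ⟨C, fun n A t ht => le_trans ?_ (hC n A t ht)⟩
    unfold evalPoly
    rw [map_mul]
    exact_mod_cast Matrix.rank_mul_le_right _ _
  | right_absorb b x _ hx =>
    obtain ⟨C, hC⟩ := hx
    refine ⟨C, fun n A t ht => le_trans ?_ (hC n A t ht)⟩
    unfold evalPoly
    rw [map_mul]
    exact_mod_cast Matrix.rank_mul_le_left _ _

/-- Finitely many elements of a two-sided ideal vanish simultaneously on a subspace whose
codimension is linearly bounded in terms of the ranks of the values of the generators. -/
theorem exists_codim_le {F : Type} [Field F] {σ ι : Type} (P : ι → FreeAlgebra F σ)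
    {T : Set (FreeAlgebra F σ)} (hfin : T.Finite)
    (hT : ∀ y ∈ T, y ∈ TwoSidedIdeal.span (Set.range P)) :
    ∃ C : ℝ, ∀ (n : ℕ) (A : σ → Matrix (Fin n) (Fin n) F) (t : ℝ),
      (∀ i, ((evalPoly (P i) A).rank : ℝ) ≤ t) →
      ∃ V : Submodule F (Fin n → F), (n : ℝ) ≤ finrank F V + C * t ∧
        ∀ y ∈ T, ∀ v ∈ V, evalPoly y A *ᵥ v = 0 := by
  induction T, hfin using Set.Finite.induction_on with
  | empty => exact ⟨0, fun n A t _ => ⟨⊤, by simp, by simp⟩⟩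
  | @insert y T _ _ ih =>
    obtain ⟨C, hC⟩ := ih fun z hz => hT z (Set.mem_insert_of_mem _ hz)
    obtain ⟨D, hD⟩ := exists_rank_evalPoly_le P (hT y (Set.mem_insert _ _))
    refine ⟨C + D, fun n A t ht => ?_⟩
    obtain ⟨V, hV, hV0⟩ := hC n A t ht
    have hy := hD n A t ht
    refine ⟨V ⊓ LinearMap.ker (evalPoly y A).mulVecLin, ?_, ?_⟩
    · have h1 := Submodule.finrank_sup_add_finrank_inf_eq V
        (LinearMap.ker (evalPoly y A).mulVecLin)
      have h2 := (V ⊔ LinearMap.ker (evalPoly y A).mulVecLin).finrank_le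
      have h3 := LinearMap.finrank_range_add_finrank_ker (evalPoly y A).mulVecLin
      rw [Module.finrank_fin_fun] at h2 h3
      have h4 : (finrank F V : ℝ) ≤ finrank F
          (V ⊓ LinearMap.ker (evalPoly y A).mulVecLin : Submodule F (Fin n → F)) +
            (evalPoly y A).rank := by
        rw [Matrix.rank]
        exact_mod_cast (by omega)
      linarith
    · rintro z (rfl | hz) v hv
      · exact hv.2
      · exact hV0 z hz v hv.1

/-- If the structure relations of the algebra, relative to a linear section `s` of `π` and a basis,
hold at `v`, then `a ↦ s(a) v` is compatible with the action of the free algebra. -/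
theorem evalPoly_mul_section_mulVec {F : Type} [Field F] {σ κ : Type} {R : Type} [Ring R]
    [Algebra F R] (π : FreeAlgebra F σ →ₐ[F] R) (s : R →ₗ[F] FreeAlgebra F σ) (b : Basis κ F R)
    {n : ℕ} (A : σ → Matrix (Fin n) (Fin n) F) (v : Fin n → F)
    (hv : ∀ j k, evalPoly (FreeAlgebra.ι F j * s (b k) - s (π (FreeAlgebra.ι F j) * b k)) A *ᵥ v
      = 0) (y : FreeAlgebra F σ) (a : R) :
    evalPoly y A *ᵥ (evalPoly (s a) A *ᵥ v) = evalPoly (s (π y * a)) A *ᵥ v := by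
  let E : FreeAlgebra F σ →ₗ[F] (Fin n → F) :=
    (Matrix.mulVecBilin F F).flip v ∘ₗ (FreeAlgebra.lift F A).toLinearMap
  have hE : ∀ z, evalPoly z A *ᵥ v = E z := fun z => rfl
  induction y using FreeAlgebra.induction generalizing a with
  | grade0 c =>
    rw [AlgHom.commutes, ← Algebra.smul_def, map_smul]
    simp [evalPoly, Algebra.algebraMap_eq_smul_one, Matrix.smul_mulVec]
  | grade1 j =>
    have h : E ∘ₗ LinearMap.mulLeft F (FreeAlgebra.ι F j) ∘ₗ s =
        E ∘ₗ s ∘ₗ LinearMap.mulLeft F (π (FreeAlgebra.ι F j)) := by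
      refine b.ext fun k => ?_
      have := hv j k
      rw [hE, map_sub, sub_eq_zero] at this
      simpa using this
    have h' := LinearMap.congr_fun h a
    rw [Matrix.mulVec_mulVec]
    simpa [E, evalPoly] using h'
  | mul y z hy hz =>
    have : evalPoly (y * z) A = evalPoly y A * evalPoly z A := map_mul _ _ _
    rw [this, ← Matrix.mulVec_mulVec, hz, hy, map_mul π, mul_assoc]
  | add y z hy hz =>
    have : evalPoly (y + z) A = evalPoly y A + evalPoly z A := map_add _ _ _
    rw [this, Matrix.add_mulVec, hy, hz, map_add, add_mul, map_add, hE, hE, hE, map_add]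

/-- In a finite-dimensional algebra, an approximate solution of the relations restricts to an exact
one on an invariant subspace of small codimension. -/
theorem exists_invariant_subspace {F : Type} [Field F] {σ ι R : Type} [Finite σ] [Ring R]
    [Algebra F R] [FiniteDimensional F R] (P : ι → FreeAlgebra F σ)
    (π : FreeAlgebra F σ →ₐ[F] R) (hπ : Function.Surjective π)
    (hker : ∀ x, π x = 0 ↔ x ∈ TwoSidedIdeal.span (Set.range P)) :
    ∃ C : ℝ, ∀ (n : ℕ) (A : σ → Matrix (Fin n) (Fin n) F) (t : ℝ),
      (∀ i, ((evalPoly (P i) A).rank : ℝ) ≤ t) →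
      ∃ W : Submodule F (Fin n → F), (n : ℝ) ≤ finrank F W + C * t ∧
        (∀ j, ∀ w ∈ W, A j *ᵥ w ∈ W) ∧ ∀ i, ∀ w ∈ W, evalPoly (P i) A *ᵥ w = 0 := by
  obtain ⟨s, hs⟩ := π.toLinearMap.exists_rightInverse_of_surjective
    (LinearMap.range_eq_top.2 hπ)
  have hs' : ∀ a, π (s a) = a := fun a => LinearMap.congr_fun hs a
  let b := Module.finBasis F R
  let T : Set (FreeAlgebra F σ) := insert (s 1 - 1) (Set.range fun p : σ × Fin (finrank F R) =>
    FreeAlgebra.ι F p.1 * s (b p.2) - s (π (FreeAlgebra.ι F p.1) * b p.2))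
  have hT : ∀ y ∈ T, y ∈ TwoSidedIdeal.span (Set.range P) := by
    rintro y (rfl | ⟨p, rfl⟩) <;> rw [← hker] <;> simp [hs']
  obtain ⟨C, hC⟩ := exists_codim_le P (Set.toFinite T) hT
  refine ⟨C, fun n A t ht => ?_⟩
  obtain ⟨V, hV, hV0⟩ := hC n A t ht
  have hact : ∀ v ∈ V, ∀ y a, evalPoly y A *ᵥ (evalPoly (s a) A *ᵥ v) =
      evalPoly (s (π y * a)) A *ᵥ v := fun v hv =>
    evalPoly_mul_section_mulVec π s b A v fun j k => hV0 _ (Or.inr ⟨(j, k), rfl⟩) v hv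
  let W : Submodule F (Fin n → F) :=
    Submodule.span F {w | ∃ v ∈ V, ∃ a, evalPoly (s a) A *ᵥ v = w}
  refine ⟨W, ?_, fun j => ?_, fun i => ?_⟩
  · have hVW : V ≤ W := by
      intro v hv
      refine Submodule.subset_span ⟨v, hv, 1, ?_⟩
      have := hV0 _ (Or.inl rfl) v hv
      simpa [evalPoly, Matrix.sub_mulVec, sub_eq_zero] using this
    have : (finrank F V : ℝ) ≤ finrank F W := by exact_mod_cast Submodule.finrank_mono hVW
    linarith
  · suffices W ≤ W.comap (A j).mulVecLin from this
    refine Submodule.span_le.2 ?_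
    rintro _ ⟨v, hv, a, rfl⟩
    have := hact v hv (FreeAlgebra.ι F j) a
    have hj : evalPoly (FreeAlgebra.ι F j) A = A j := FreeAlgebra.lift_ι_apply _ _
    rw [hj] at this
    refine Submodule.subset_span ⟨v, hv, _, this.symm⟩
  · suffices W ≤ LinearMap.ker (evalPoly (P i) A).mulVecLin from this
    refine Submodule.span_le.2 ?_
    rintro _ ⟨v, hv, a, rfl⟩
    have hPi : π (P i) = 0 := (hker _).2 (TwoSidedIdeal.subset_span ⟨i, rfl⟩)
    have := hact v hv (P i) a
    rw [hPi, zero_mul, map_zero] at this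
    simpa [evalPoly] using this

/-- **Finite-dimensional algebras are rank-stable.** If `A` is a finite-dimensional
`F`-algebra and `F⟨x_1,…,x_d⟩/⟨P_1,…,P_r⟩` is any presentation of `A`, then this
presentation is rank-stable. -/
theorem stmt1_finite_dimensional_rank_stable
    (F : Type) [Field F] (d r : ℕ)
    (P : Fin r → FreeAlgebra F (Fin d))
    (A : Type) [Ring A] [Algebra F A] [FiniteDimensional F A]
    (π : FreeAlgebra F (Fin d) →ₐ[F] A)
    (hπ : Function.Surjective π)
    (hker : ∀ x, π x = 0 ↔ x ∈ TwoSidedIdeal.span (Set.range P)) :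
    RankStable F P := by
  obtain ⟨C, hC⟩ := exists_invariant_subspace P π hπ hker
  intro ε hε
  have hD : 0 < |C| + 1 := by positivity
  refine ⟨min 1 (ε / 3) / (|C| + 1), by positivity, fun n hn M hM => ?_⟩
  have hn' : (0 : ℝ) < n := by exact_mod_cast hn
  obtain ⟨W, hWn, hW, hWP⟩ := hC n M _ fun i => (hM i).le
  obtain ⟨B, hB, hMB⟩ := exists_solution_of_invariant P M W hW hWP
  have hlt : (n : ℝ) - finrank F W < min 1 (ε / 3) * n := by
    have hmin : 0 < min 1 (ε / 3) * n := by positivity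
    calc (n : ℝ) - finrank F W
        ≤ C * (min 1 (ε / 3) / (|C| + 1) * n) := by linarith
      _ = C / (|C| + 1) * (min 1 (ε / 3) * n) := by ring
      _ < 1 * (min 1 (ε / 3) * n) := by
          refine mul_lt_mul_of_pos_right ?_ hmin
          rw [div_lt_one hD]
          linarith [le_abs_self C]
      _ = _ := one_mul _
  have h1 : min 1 (ε / 3) * n ≤ 1 * n := by gcongr; exact min_le_left _ _
  have h2 : min 1 (ε / 3) * n ≤ ε / 3 * n := by gcongr; exact min_le_right _ _
  refine ⟨finrank F W, ?_, B, hB, fun j => ?_⟩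
  · have : (0 : ℝ) < finrank F W := by linarith
    exact_mod_cast this
  · have hle : finrank F W ≤ n := by simpa using W.finrank_le
    have h3 : (padRankDiff (M j) (B j) : ℝ) ≤ 3 * (n - finrank F W) := by
      have := hMB j
      rw [← Nat.cast_sub hle]
      exact_mod_cast this
    linarith
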